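/- arXiv:2003.05306 — 4 statements merged into one kernel-verified Lean document; each statement's English description precedes it below -/
import Mathlib

section
/- Let α > 0, let n, m be nonnegative integers, let j be an integer, and let α_j be the (unique) positive real solution of sinh(α_j) = α cos(πj/(2n+1)) (assuming cos(πj/(2n+1)) > 0). Then 2 arctan( ( sqrt(1 + α² cos²(πj/(2n+1))) − α cos(πj/(2n+1)) )^{2m+1} ) = π/2 − arctan( sinh((2m+1) α_j) ). -/
open Real

theorem two_arctan_eq (α : ℝ) (hα : 0 < α) (n m : ℕ) (j : ℤ)
    (hcos : 0 < Real.cos (π * j / (2 * n + 1))) (αj : ℝ) (hαj : 0 < αj)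
    (hsinh : Real.sinh αj = α * Real.cos (π * j / (2 * n + 1))) :
    2 * Real.arctan ((Real.sqrt (1 + α ^ 2 * Real.cos (π * j / (2 * n + 1)) ^ 2) -
      α * Real.cos (π * j / (2 * n + 1))) ^ (2 * m + 1)) =
    π / 2 - Real.arctan (Real.sinh ((2 * m + 1) * αj)) := by
  have h1 : 1 + α ^ 2 * Real.cos (π * j / (2 * n + 1)) ^ 2 = Real.cosh αj ^ 2 := by
    rw [← mul_pow, ← hsinh, Real.cosh_sq]; ring
  rw [h1, Real.sqrt_sq (Real.cosh_pos _).le, ← hsinh, Real.cosh_sub_sinh, ← Real.exp_nat_mul]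
  have ht : 0 < (2 * (m : ℝ) + 1) * αj := by positivity
  have h2 : ((2 * m + 1 : ℕ) : ℝ) * -αj = -((2 * (m : ℝ) + 1) * αj) := by push_cast; ring
  rw [h2]
  generalize (2 * (m : ℝ) + 1) * αj = t at ht
  rw [← Real.arctan_inv_of_pos (Real.sinh_pos_iff.2 ht)]
  have hx0 := Real.exp_pos (-t)
  have hx1 : Real.exp (-t) < 1 := by rw [← Real.exp_zero]; exact Real.exp_lt_exp.2 (by linarith)
  have hx2 : Real.exp (-t) * Real.exp (-t) < 1 := by nlinarith
  rw [two_mul, Real.arctan_add hx2]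
  congr 1
  have hs := Real.sinh_pos_iff.2 ht
  have he : Real.exp t * Real.exp (-t) = 1 := by rw [← Real.exp_add]; simp
  have h3 : (1 - Real.exp (-t) * Real.exp (-t)) ≠ 0 := by intro h; linarith
  rw [eq_comm, inv_eq_iff_eq_inv, inv_div, eq_div_iff (by positivity), Real.sinh_eq]
  linear_combination he
end

section
/- For every real s: √3 · ∫_s^∞ sinh(t)/sinh(3t) dt = π/6 − arctan( tanh(s)/√3 ) = arctan( √3 / (1 + 2 e^{2s}) ). -/
open Real MeasureTheory

theorem aux_tanh (s : ℝ) : Real.tanh s = (Real.exp (2 * s) - 1) / (Real.exp (2 * s) + 1) := by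
  have h : Real.exp (2 * s) = Real.exp s ^ 2 := by rw [← Real.exp_nat_mul]; norm_num
  have hp := Real.exp_pos s
  rw [Real.tanh_eq_sinh_div_cosh, Real.sinh_eq, Real.cosh_eq, Real.exp_neg, h]
  field_simp

theorem aux_two (s : ℝ) : π / 6 - Real.arctan (Real.tanh s / Real.sqrt 3) =
      Real.arctan (Real.sqrt 3 / (1 + 2 * Real.exp (2 * s))) := by
  rw [aux_tanh, sub_eq_iff_eq_add, ← Real.arctan_inv_sqrt_three]
  have hE := Real.exp_pos (2 * s)
  generalize Real.exp (2 * s) = E at hE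
  have h3 : 0 < Real.sqrt 3 := by positivity
  have h33 : Real.sqrt 3 ^ 2 = 3 := Real.sq_sqrt (by norm_num)
  have hprod : Real.sqrt 3 / (1 + 2 * E) * ((E - 1) / (E + 1) / Real.sqrt 3)
      = (E - 1) / ((1 + 2 * E) * (E + 1)) := by
    field_simp
  have hlt : (E - 1) / ((1 + 2 * E) * (E + 1)) < 1 := by
    rw [div_lt_one (by positivity)]; nlinarith
  rw [Real.arctan_add (by rw [hprod]; exact hlt), hprod]
  congr 1
  have hne : 1 - (E - 1) / ((1 + 2 * E) * (E + 1)) ≠ 0 := by linarith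
  rw [eq_div_iff hne]
  field_simp
  rw [h33]
  ring

theorem aux_deriv (t : ℝ) :
    HasDerivAt (fun t => -Real.arctan (Real.sqrt 3 / (1 + 2 * Real.exp (2 * t))))
      (Real.sqrt 3 * (Real.exp (2 * t) / (Real.exp (2 * t) ^ 2 + Real.exp (2 * t) + 1))) t := by
  have h1 : HasDerivAt (fun t : ℝ => 1 + 2 * Real.exp (2 * t)) (2 * (Real.exp (2 * t) * (2 * 1))) t :=
    ((((hasDerivAt_id t).const_mul 2).exp).const_mul 2).const_add 1
  have hE := Real.exp_pos (2 * t)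
  have h2 := (((hasDerivAt_const t (Real.sqrt 3)).div h1 (by positivity)).arctan).neg
  refine h2.congr_deriv ?_
  simp only [Pi.div_apply]
  generalize Real.exp (2 * t) = E at hE
  have h33 : Real.sqrt 3 ^ 2 = 3 := Real.sq_sqrt (by norm_num)
  rw [div_pow, h33]
  have : (1 + 2 * E) ^ 2 + 3 ≠ 0 := by positivity
  field_simp
  ring

theorem aux_integrand (t : ℝ) (ht : t ≠ 0) : Real.sinh t / Real.sinh (3 * t) =
    Real.exp (2 * t) / (Real.exp (2 * t) ^ 2 + Real.exp (2 * t) + 1) := by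
  have h : Real.exp (2 * t) = Real.exp t ^ 2 := by rw [← Real.exp_nat_mul]; norm_num
  have hp := Real.exp_pos t
  have hs : Real.sinh t ≠ 0 := by simpa using ht
  have hs3 : Real.sinh (3 * t) ≠ 0 := by simpa using ht
  rw [div_eq_div_iff hs3 (by positivity), Real.sinh_three_mul, Real.sinh_eq, Real.exp_neg, h]
  field_simp
  ring

theorem aux_one (s : ℝ) : Real.sqrt 3 * (∫ t in Set.Ioi s, Real.sinh t / Real.sinh (3 * t)) =
    Real.arctan (Real.sqrt 3 / (1 + 2 * Real.exp (2 * s))) := by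
  rw [← integral_const_mul]
  have hae : (fun t => Real.sqrt 3 * (Real.sinh t / Real.sinh (3 * t)))
      =ᵐ[volume.restrict (Set.Ioi s)] fun t => Real.sqrt 3 *
        (Real.exp (2 * t) / (Real.exp (2 * t) ^ 2 + Real.exp (2 * t) + 1)) := by
    apply ae_restrict_of_ae
    filter_upwards [Measure.ae_ne volume (0 : ℝ)] with t ht
    rw [aux_integrand t ht]
  rw [integral_congr_ae hae]
  have hlim : Filter.Tendsto (fun t => -Real.arctan (Real.sqrt 3 / (1 + 2 * Real.exp (2 * t))))
      Filter.atTop (nhds 0) := by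
    have h1 : Filter.Tendsto (fun t : ℝ => 1 + 2 * Real.exp (2 * t)) Filter.atTop Filter.atTop :=
      Filter.tendsto_atTop_add_const_left _ _ ((Real.tendsto_exp_atTop.comp
        (Filter.tendsto_id.const_mul_atTop (by norm_num : (0:ℝ) < 2))).const_mul_atTop
          (by norm_num : (0:ℝ) < 2))
    have h2 := ((Real.continuous_arctan.tendsto 0).comp
      (h1.const_div_atTop (Real.sqrt 3))).neg
    simpa using h2
  rw [integral_Ioi_of_hasDerivAt_of_nonneg' (fun x _ => aux_deriv x)
    (fun x _ => by positivity) hlim]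
  ring

theorem integral_sinh_div_sinh_three (s : ℝ) :
    Real.sqrt 3 * (∫ t in Set.Ioi s, Real.sinh t / Real.sinh (3 * t)) =
      π / 6 - Real.arctan (Real.tanh s / Real.sqrt 3) ∧
    π / 6 - Real.arctan (Real.tanh s / Real.sqrt 3) =
      Real.arctan (Real.sqrt 3 / (1 + 2 * Real.exp (2 * s))) :=
  ⟨(aux_one s).trans (aux_two s).symm, aux_two s⟩
end

section
/- Let α, β be positive reals with αβ = π²/4. Then Σ_{n=1}^{∞} χ(n) arctan(e^{−αn}) + Σ_{n=1}^{∞} χ(n) arctan(e^{−βn}) = π/8, where χ(n) = sin(πn/2) is the nontrivial Dirichlet character modulo 4 (χ(n) = 1 for n ≡ 1 mod 4, χ(n) = −1 for n ≡ 3 mod 4, χ(n) = 0 for even n). -/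
open Real

/-- paired difference -/
noncomputable def pr (g : ℝ → ℝ) (k : ℕ) : ℝ := g (4 * k + 1) - g (4 * k + 3)

lemma pr_bound (d : ℝ) (hd : 0 ≤ d) (p : ℕ) :
    |pr (fun m => m / (m ^ 2 + d)) p| ≤ 2 / (((p : ℝ) + 1) ^ 2 + d) := by
  have hp : (0 : ℝ) ≤ p := Nat.cast_nonneg p
  have h1 : 0 < (4 * (p : ℝ) + 1) ^ 2 + d := by positivity
  have h3 : 0 < (4 * (p : ℝ) + 3) ^ 2 + d := by positivity
  have h0 : 0 < ((p : ℝ) + 1) ^ 2 + d := by positivity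
  have e : pr (fun m => m / (m ^ 2 + d)) p =
      2 * ((4 * (p : ℝ) + 1) * (4 * p + 3) - d) /
        (((4 * (p : ℝ) + 1) ^ 2 + d) * ((4 * (p : ℝ) + 3) ^ 2 + d)) := by
    simp only [pr]
    field_simp
    ring
  have key : |2 * ((4 * (p : ℝ) + 1) * (4 * p + 3) - d)| ≤ 2 * ((4 * (p : ℝ) + 3) ^ 2 + d) := by
    rw [abs_le]; constructor <;> nlinarith
  rw [e, abs_div, abs_of_pos (mul_pos h1 h3)]
  by_cases hp0 : p = 0
  · subst hp0
    have key : |2 * ((4 * ((0:ℕ) : ℝ) + 1) * (4 * ((0:ℕ):ℝ) + 3) - d)| ≤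
        2 * ((4 * ((0:ℕ) : ℝ) + 3) ^ 2 + d) := key
    rw [div_le_div_iff₀ (mul_pos h1 h3) h0]
    simp only [Nat.cast_zero] at *
    nlinarith
  · rw [div_le_div_iff₀ (mul_pos h1 h3) h0]
    have h10 : ((p : ℝ) + 1) ^ 2 + d ≤ (4 * (p : ℝ) + 1) ^ 2 + d := by nlinarith
    calc _ ≤ 2 * ((4 * (p : ℝ) + 3) ^ 2 + d) * ((4 * (p : ℝ) + 1) ^ 2 + d) := by gcongr
      _ = _ := by ring

lemma summable_sq : Summable (fun p : ℕ => 1 / ((p : ℝ) + 1) ^ 2) := by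
  have := (summable_nat_add_iff 1).mpr (Real.summable_one_div_nat_pow.mpr (one_lt_two))
  simpa using this

lemma summable_pr (d : ℝ) (hd : 0 ≤ d) : Summable (pr (fun m => m / (m ^ 2 + d))) := by
  refine Summable.of_norm_bounded (summable_sq.mul_left 2) (fun p => ?_)
  rw [Real.norm_eq_abs]
  refine (pr_bound d hd p).trans ?_
  rw [mul_one_div]
  gcongr
  linarith

open Filter Topology in
lemma sech_aux (y : ℝ) :
    HasSum (pr (fun m => m / (m ^ 2 + 16 * y ^ 2))) (π / 4 * (1 / Real.cosh (2 * π * y))) := by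
  rw [(summable_pr _ (by positivity)).hasSum_iff_tendsto_nat]
  set z : ℂ := 1 / 4 - Complex.I * y with hz
  set w : ℂ := 1 / 4 + Complex.I * y with hw
  have hzc : z ∈ Complex.integerComplement := by
    rw [Complex.mem_integerComplement_iff]
    rintro ⟨n, hn⟩
    have := congrArg Complex.re hn
    simp [hz] at this
    have h4 : (4 * n : ℝ) = 1 := by rw [this]; norm_num
    have h5 : 4 * n = 1 := by exact_mod_cast h4
    omega
  have hwc : w ∈ Complex.integerComplement := by
    rw [Complex.mem_integerComplement_iff]
    rintro ⟨n, hn⟩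
    have := congrArg Complex.re hn
    simp [hw] at this
    have h4 : (4 * n : ℝ) = 1 := by rw [this]; norm_num
    have h5 : 4 * n = 1 := by exact_mod_cast h4
    omega
  have hcot := (tendsto_logDeriv_euler_cot_sub hzc).add (tendsto_logDeriv_euler_cot_sub hwc)
  have hsz := sin_pi_mul_ne_zero hzc
  have hsw := sin_pi_mul_ne_zero hwc
  have hcosh : (Real.cosh (2 * π * y) : ℂ) ≠ 0 := by
    exact_mod_cast (Real.cosh_pos _).ne'
  have hval : Complex.cot (π * z) + Complex.cot (π * w) = 2 / (Real.cosh (2 * π * y) : ℂ) := by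
    have e1 : Complex.sin (π * z + π * w) = 1 := by
      rw [show (π * z + π * w : ℂ) = π / 2 by rw [hz, hw]; ring, Complex.sin_pi_div_two]
    have e1' : Complex.cos (π * z + π * w) = 0 := by
      rw [show (π * z + π * w : ℂ) = π / 2 by rw [hz, hw]; ring, Complex.cos_pi_div_two]
    have e2 : Complex.cos (π * w - π * z) = (Real.cosh (2 * π * y) : ℂ) := by
      rw [show (π * w - π * z : ℂ) = (2 * π * y : ℂ) * Complex.I by rw [hz, hw]; ring,
        Complex.cos_mul_I]
      push_cast; rfl
    rw [Complex.sin_add] at e1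
    rw [Complex.cos_add] at e1'
    rw [Complex.cos_sub] at e2
    rw [Complex.cot, Complex.cot, ← e2, div_add_div _ _ hsz hsw, div_eq_div_iff (mul_ne_zero hsz hsw)]
    · linear_combination (Complex.cos (↑π * w) * Complex.cos (↑π * z) +
        Complex.sin (↑π * w) * Complex.sin (↑π * z)) * e1 + e1'
    · rw [e2]; exact hcosh
  have hterm : ∀ k : ℕ, cotTerm z k + cotTerm w k =
      ((8 * ((4 * k + 5) / ((4 * k + 5) ^ 2 + 16 * y ^ 2)
        - (4 * k + 3) / ((4 * k + 3) ^ 2 + 16 * y ^ 2)) : ℝ) : ℂ) := by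
    intro k
    have n1 : z - (k + 1) ≠ 0 := by
      simpa [sub_eq_add_neg] using Complex.integerComplement_add_ne_zero hzc (-(k + 1) : ℤ)
    have n2 : w - (k + 1) ≠ 0 := by
      simpa [sub_eq_add_neg] using Complex.integerComplement_add_ne_zero hwc (-(k + 1) : ℤ)
    have n3 : z + (k + 1) ≠ 0 := by
      simpa using Complex.integerComplement_add_ne_zero hzc ((k : ℤ) + 1)
    have n4 : w + (k + 1) ≠ 0 := by
      simpa using Complex.integerComplement_add_ne_zero hwc ((k : ℤ) + 1)
    have d5 : ((4 * k + 5) ^ 2 + 16 * y ^ 2 : ℂ) = 16 * ((z + (k + 1)) * (w + (k + 1))) := by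
      rw [hz, hw]; linear_combination (16 * y ^ 2 : ℂ) * Complex.I_sq
    have d3 : ((4 * k + 3) ^ 2 + 16 * y ^ 2 : ℂ) = 16 * ((z - (k + 1)) * (w - (k + 1))) := by
      rw [hz, hw]; linear_combination (16 * y ^ 2 : ℂ) * Complex.I_sq
    have s5 : (4 * k + 5 : ℂ) = 2 * ((z + (k + 1)) + (w + (k + 1))) := by rw [hz, hw]; ring
    have s3 : (4 * k + 3 : ℂ) = -2 * ((z - (k + 1)) + (w - (k + 1))) := by rw [hz, hw]; ring
    push_cast
    rw [d5, d3, s5, s3]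
    simp only [cotTerm]
    generalize z - (k + 1 : ℂ) = a at *
    generalize w - (k + 1 : ℂ) = b at *
    generalize z + (k + 1 : ℂ) = c at *
    generalize w + (k + 1 : ℂ) = d at *
    field_simp
    ring
  have h0 : 1 / z + 1 / w = ((8 * (1 / (1 + 16 * y ^ 2)) : ℝ) : ℂ) := by
    have n1 := Complex.integerComplement.ne_zero hzc
    have n2 := Complex.integerComplement.ne_zero hwc
    have d : (1 + 16 * y ^ 2 : ℂ) = 16 * (z * w) := by
      rw [hz, hw]; linear_combination (16 * y ^ 2 : ℂ) * Complex.I_sq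
    have s : z + w = 1 / 2 := by rw [hz, hw]; ring
    push_cast
    rw [d]
    field_simp
    linear_combination 2 * s
  have hpart : ∀ N : ℕ, ∑ k ∈ Finset.range N, pr (fun m => m / (m ^ 2 + 16 * y ^ 2)) k =
      (1 / 8) * ∑ k ∈ Finset.range N, (8 * ((4 * (k : ℝ) + 5) / ((4 * k + 5) ^ 2 + 16 * y ^ 2)
        - (4 * k + 3) / ((4 * k + 3) ^ 2 + 16 * y ^ 2))) + 1 / (1 + 16 * y ^ 2)
        - (4 * (N : ℝ) + 1) / ((4 * N + 1) ^ 2 + 16 * y ^ 2) := by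
    intro N
    induction N with
    | zero => simp
    | succ n ih =>
      rw [Finset.sum_range_succ, ih, Finset.sum_range_succ]
      simp only [pr]
      push_cast
      rw [show 4 * ((n : ℝ) + 1) + 1 = 4 * n + 5 by ring]
      ring
  have hreal : Tendsto (fun N : ℕ => ∑ k ∈ Finset.range N,
      (8 * ((4 * (k : ℝ) + 5) / ((4 * k + 5) ^ 2 + 16 * y ^ 2)
        - (4 * k + 3) / ((4 * k + 3) ^ 2 + 16 * y ^ 2)))) atTop
      (𝓝 (2 * π / Real.cosh (2 * π * y) - 8 * (1 / (1 + 16 * y ^ 2)))) := by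
    rw [← tendsto_ofReal_iff]
    convert hcot using 2
    · rename_i N
      rw [← Finset.sum_add_distrib, Finset.sum_congr rfl (fun k _ => hterm k)]
      push_cast
      rfl
    · have : (π * Complex.cot (π * z) - 1 / z + (π * Complex.cot (π * w) - 1 / w) : ℂ) =
        π * (Complex.cot (π * z) + Complex.cot (π * w)) - (1 / z + 1 / w) := by ring
      rw [this, hval, h0]
      push_cast
      ring
  have hlim : Tendsto (fun N : ℕ => (4 * (N : ℝ) + 1) / ((4 * N + 1) ^ 2 + 16 * y ^ 2))
      atTop (𝓝 0) := by
    refine squeeze_zero (fun N => by positivity) (fun N => ?_)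
      tendsto_one_div_add_atTop_nhds_zero_nat
    rw [div_le_div_iff₀ (by positivity) (by positivity)]
    have : (0 : ℝ) ≤ N := Nat.cast_nonneg N
    nlinarith [sq_nonneg y]
  have := ((hreal.const_mul (1 / 8)).add_const (1 / (1 + 16 * y ^ 2))).sub hlim
  refine (this.congr (fun N => (hpart N).symm)).trans ?_
  apply le_of_eq
  congr 1
  ring

lemma hasSum_sech (x : ℝ) : HasSum (pr (fun m => m / (m ^ 2 + 4 / π ^ 2 * x ^ 2)))
    (π / 4 * (1 / Real.cosh x)) := by
  have h := sech_aux (x / (2 * π))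
  rw [show 2 * π * (x / (2 * π)) = x by field_simp] at h
  rwa [show 16 * (x / (2 * π)) ^ 2 = 4 / π ^ 2 * x ^ 2 by field_simp; ring] at h

lemma four_ineq (x y : ℝ) (hx : 0 ≤ x) (hy : 0 ≤ y) : x ^ 3 * y ≤ x ^ 4 + y ^ 4 := by
  rcases le_total x y with h | h
  · have : x ^ 3 * y ≤ y ^ 3 * y := by gcongr
    nlinarith [pow_nonneg hx 4]
  · have : x ^ 3 * y ≤ x ^ 3 * x := by gcongr
    nlinarith [pow_nonneg hy 4]

lemma summable_sqrt : Summable (fun p : ℕ => 1 / (Real.sqrt ((p : ℝ) + 1)) ^ 3) := by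
  have := (summable_nat_add_iff 1).mpr
    (Real.summable_one_div_nat_rpow.mpr (show (1 : ℝ) < 3 / 2 by norm_num))
  refine this.congr (fun p => ?_)
  rw [Real.sqrt_eq_rpow, ← Real.rpow_natCast, ← Real.rpow_mul (by positivity)]
  push_cast
  norm_num

lemma b_bound (c : ℝ) (hc : 0 < c) (p q : ℕ) (j : ℝ) (hj : (q : ℝ) + 1 ≤ j) :
    |1 / j * pr (fun m => m / (m ^ 2 + c * j ^ 2)) p| ≤
      2 / min 1 c * (1 / (Real.sqrt ((q : ℝ) + 1)) ^ 3 * (1 / (Real.sqrt ((p : ℝ) + 1)) ^ 3)) := by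
  have hq1 : (0 : ℝ) < (q : ℝ) + 1 := by positivity
  have hp1 : (0 : ℝ) < (p : ℝ) + 1 := by positivity
  have hj0 : 0 < j := hq1.trans_le hj
  have hm : 0 < min 1 c := lt_min one_pos hc
  set Y := Real.sqrt ((q : ℝ) + 1) with hY
  set X := Real.sqrt ((p : ℝ) + 1) with hX
  have hY0 : 0 < Y := Real.sqrt_pos.mpr hq1
  have hX0 : 0 < X := Real.sqrt_pos.mpr hp1
  have hY2 : Y ^ 2 = q + 1 := Real.sq_sqrt hq1.le
  have hX2 : X ^ 2 = p + 1 := Real.sq_sqrt hp1.le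
  have h1 := pr_bound (c * j ^ 2) (by positivity) p
  rw [abs_mul, abs_of_pos (by positivity : 0 < 1 / j)]
  have h2 : min 1 c * (X ^ 3 * Y) ≤ ((p : ℝ) + 1) ^ 2 + c * j ^ 2 := by
    have e1 : ((p : ℝ) + 1) ^ 2 = X ^ 4 := by rw [← hX2]; ring
    have e2 : Y ^ 4 ≤ j ^ 2 := by
      rw [← hY2] at hj
      calc Y ^ 4 = (Y ^ 2) ^ 2 := by ring
        _ ≤ j ^ 2 := by gcongr
    have e3 := four_ineq X Y hX0.le hY0.le
    calc min 1 c * (X ^ 3 * Y) ≤ min 1 c * (X ^ 4 + Y ^ 4) := by gcongr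
      _ = min 1 c * X ^ 4 + min 1 c * Y ^ 4 := by ring
      _ ≤ 1 * X ^ 4 + c * j ^ 2 := by
        gcongr
        · exact min_le_left _ _
        · exact min_le_right _ _
      _ = _ := by rw [e1]; ring
  calc 1 / j * |pr (fun m => m / (m ^ 2 + c * j ^ 2)) p|
      ≤ 1 / Y ^ 2 * (2 / (min 1 c * (X ^ 3 * Y))) := by
        gcongr
        · rw [hY2]; exact hj
        · exact h1.trans (by gcongr)
    _ = _ := by field_simp

noncomputable def dbl (c : ℝ) (q p : ℕ) : ℝ :=
  pr (fun j => 1 / j * pr (fun m => m / (m ^ 2 + c * j ^ 2)) p) q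

lemma summable_dbl (c : ℝ) (hc : 0 < c) : Summable (Function.uncurry (dbl c)) := by
  have hs := (summable_sqrt.mul_of_nonneg summable_sqrt (fun p => by positivity)
    (fun p => by positivity)).mul_left (2 / min 1 c)
  refine Summable.of_norm_bounded (hs.add hs) ?_
  rintro ⟨q, p⟩
  have hq : (0 : ℝ) ≤ q := Nat.cast_nonneg q
  simp only [Function.uncurry, dbl]
  rw [Real.norm_eq_abs]
  unfold pr
  refine (abs_sub _ _).trans (add_le_add ?_ ?_)
  · exact b_bound c hc p q (4 * q + 1) (by linarith)
  · exact b_bound c hc p q (4 * q + 3) (by linarith)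

lemma hasSum_dbl (a : ℝ) (q : ℕ) : HasSum (dbl (4 / π ^ 2 * a ^ 2) q)
    (pr (fun j => 1 / j * (π / 4 * (1 / Real.cosh (a * j)))) q) := by
  have h (j : ℝ) : HasSum (fun p => 1 / j * pr (fun m => m / (m ^ 2 + 4 / π ^ 2 * a ^ 2 * j ^ 2)) p)
      (1 / j * (π / 4 * (1 / Real.cosh (a * j)))) := by
    have := (hasSum_sech (a * j)).mul_left (1 / j)
    rwa [mul_pow, ← mul_assoc] at this
  exact (h _).sub (h _)

lemma hasSum_leib : HasSum (pr (fun m => 1 / m)) (π / 4) := by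
  have := hasSum_sech 0
  simp only [Real.cosh_zero] at this
  convert this using 1
  · congr 1
    ext m
    by_cases hm : m = 0
    · simp [hm]
    · field_simp
      simp
  · ring

lemma dbl_add (c c' : ℝ) (hc : 0 < c) (hc' : 0 < c') (h : c * c' = 1) (p q : ℕ) :
    dbl c q p = pr (fun m => 1 / m) p * pr (fun m => 1 / m) q - dbl c' p q := by
  have key (m j : ℝ) (hm : 0 < m) (hj : 0 < j) :
      1 / j * (m / (m ^ 2 + c * j ^ 2)) = 1 / m * (1 / j) - 1 / m * (j / (j ^ 2 + c' * m ^ 2)) := by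
    have e : j ^ 2 + c' * m ^ 2 = c' * (m ^ 2 + c * j ^ 2) := by linear_combination (-j ^ 2) * h
    have : 0 < m ^ 2 + c * j ^ 2 := by positivity
    rw [e]
    field_simp
    linear_combination (-j ^ 2) * h
  have hp : (0 : ℝ) ≤ p := Nat.cast_nonneg p
  have hq : (0 : ℝ) ≤ q := Nat.cast_nonneg q
  simp only [dbl, pr, mul_sub]
  rw [key (4 * p + 1) (4 * q + 1) (by linarith) (by linarith),
    key (4 * p + 1) (4 * q + 3) (by linarith) (by linarith),
    key (4 * p + 3) (4 * q + 1) (by linarith) (by linarith),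
    key (4 * p + 3) (4 * q + 3) (by linarith) (by linarith)]
  ring

noncomputable def KK (a : ℝ) : ℝ := ∑' q, pr (fun j => 1 / j * (π / 4 * (1 / Real.cosh (a * j)))) q

lemma summable_KK (a : ℝ) (ha : 0 < a) :
    Summable (pr (fun j => 1 / j * (π / 4 * (1 / Real.cosh (a * j))))) := by
  have h := summable_dbl (4 / π ^ 2 * a ^ 2) (by positivity)
  exact (h.hasSum.prod_fiberwise (fun q => hasSum_dbl a q)).summable

lemma KK_add (α β : ℝ) (hα : 0 < α) (hβ : 0 < β) (hαβ : α * β = π ^ 2 / 4) :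
    KK α + KK β = π ^ 2 / 16 := by
  have hcc : (4 / π ^ 2 * β ^ 2) * (4 / π ^ 2 * α ^ 2) = 1 := by
    have : (4 / π ^ 2 * β ^ 2) * (4 / π ^ 2 * α ^ 2) = 16 / π ^ 4 * (α * β) ^ 2 := by ring
    rw [this, hαβ]; field_simp; norm_num
  have h := summable_dbl (4 / π ^ 2 * β ^ 2) (by positivity)
  have hb : KK β = ∑' q, ∑' p, dbl (4 / π ^ 2 * β ^ 2) q p :=
    tsum_congr (fun q => (hasSum_dbl β q).tsum_eq.symm)
  rw [← h.tsum_comm] at hb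
  have hin (p : ℕ) : ∑' q, dbl (4 / π ^ 2 * β ^ 2) q p = pr (fun m => 1 / m) p * (π / 4) -
      pr (fun j => 1 / j * (π / 4 * (1 / Real.cosh (α * j)))) p := by
    rw [tsum_congr (fun q => dbl_add _ _ (by positivity) (by positivity) hcc p q)]
    exact ((hasSum_leib.mul_left _).sub (hasSum_dbl α p)).tsum_eq
  rw [tsum_congr hin, ((hasSum_leib.mul_right (π / 4)).sub (summable_KK α hα).hasSum).tsum_eq] at hb
  rw [hb, KK]
  ring

lemma arctan_sum (a : ℝ) (ha : 0 < a) :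
    ∑' n : ℕ, Real.sin (π * n / 2) * Real.arctan (Real.exp (-(a * n))) = 2 / π * KK a := by
  have hinj : Function.Injective (fun l : ℕ => 2 * l + 1) := fun x y h => by
    simp only at h; omega
  rw [← hinj.tsum_eq]
  swap
  · intro n hn
    rcases Nat.even_or_odd' n with ⟨k, rfl | rfl⟩
    · exfalso
      apply hn
      simp only
      rw [show π * ((2 * k : ℕ) : ℝ) / 2 = k * π by push_cast; ring, Real.sin_nat_mul_pi, zero_mul]
    · exact ⟨k, rfl⟩
  set r := Real.exp (-a) with hr
  have hr0 : 0 < r := Real.exp_pos _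
  have hr1 : r < 1 := by rw [hr]; rw [Real.exp_lt_one_iff] ; linarith
  let f : ℕ → ℕ → ℝ := fun l k => (-1) ^ l * ((-1) ^ k * (r ^ (2 * l + 1)) ^ (2 * k + 1) / ((2 * k + 1 : ℕ) : ℝ))
  have hterm (l : ℕ) : Real.sin (π * ((2 * l + 1 : ℕ) : ℝ) / 2) *
      Real.arctan (Real.exp (-(a * ((2 * l + 1 : ℕ) : ℝ)))) = ∑' k, f l k := by
    have e1 : Real.sin (π * ((2 * l + 1 : ℕ) : ℝ) / 2) = (-1) ^ l := by
      rw [show π * ((2 * l + 1 : ℕ) : ℝ) / 2 = π / 2 + l * π by push_cast; ring,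
        Real.sin_add_nat_mul_pi]
      simp
    have e2 : Real.exp (-(a * ((2 * l + 1 : ℕ) : ℝ))) = r ^ (2 * l + 1) := by
      rw [hr, ← Real.exp_nat_mul]; congr 1; ring
    rw [e1, e2]
    have hlt : ‖r ^ (2 * l + 1)‖ < 1 := by
      rw [Real.norm_of_nonneg (by positivity)]
      exact pow_lt_one₀ hr0.le hr1 (by omega)
    exact ((Real.hasSum_arctan hlt).mul_left _).tsum_eq.symm
  have hsum : Summable (Function.uncurry f) := by
    have hg := summable_geometric_of_lt_one hr0.le hr1
    refine Summable.of_norm_bounded (hg.mul_of_nonneg hg (fun p => by positivity)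
      (fun p => by positivity)) ?_
    rintro ⟨l, k⟩
    simp only [Function.uncurry, f]
    rw [norm_mul, norm_div, norm_mul, norm_pow, norm_pow, norm_neg, norm_one, one_pow, one_pow,
      one_mul, one_mul, ← pow_mul, Real.norm_of_nonneg (by positivity),
      Real.norm_of_nonneg (by positivity), ← pow_add]
    refine (div_le_self (by positivity) (by push_cast; linarith [(Nat.cast_nonneg k : (0:ℝ) ≤ k)])).trans ?_
    exact pow_le_pow_of_le_one hr0.le hr1.le (by nlinarith)
  rw [tsum_congr hterm, ← hsum.tsum_comm]
  let h : ℕ → ℝ := fun k => (-1) ^ k * (1 / (2 * k + 1) * (1 / (2 * Real.cosh (a * (2 * k + 1)))))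
  have hinner (k : ℕ) : HasSum (fun l => f l k) (h k) := by
    have hs0 : 0 < r ^ (2 * k + 1) := by positivity
    have hs1 : r ^ (2 * k + 1) < 1 := pow_lt_one₀ hr0.le hr1 (by omega)
    have hcosh : Real.cosh (a * (2 * k + 1)) = (r ^ (2 * k + 1) + (r ^ (2 * k + 1))⁻¹) / 2 := by
      rw [Real.cosh_eq, hr, ← Real.exp_nat_mul, ← Real.exp_neg, add_comm]
      congr 3 <;> (push_cast; ring)
    set s := r ^ (2 * k + 1) with hs
    have hgeo := hasSum_geometric_of_abs_lt_one (r := -s ^ 2)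
      (by rw [abs_neg, abs_of_pos (by positivity)]; exact pow_lt_one₀ hs0.le hs1 (by norm_num))
    have hg2 := hgeo.mul_left ((-1) ^ k * (s / (2 * k + 1)))
    have e1 : (fun l => f l k) = fun l => (-1) ^ k * (s / (2 * k + 1)) * (-s ^ 2) ^ l := by
      funext l
      change (-1) ^ l * ((-1) ^ k * (r ^ (2 * l + 1)) ^ (2 * k + 1) / ((2 * k + 1 : ℕ) : ℝ)) = _
      rw [← pow_mul, mul_comm (2 * l + 1), pow_mul, ← hs, neg_pow (s ^ 2)]
      push_cast
      ring
    have e2 : h k = (-1) ^ k * (s / (2 * k + 1)) * (1 - -s ^ 2)⁻¹ := by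
      change (-1) ^ k * (1 / (2 * k + 1) * (1 / (2 * Real.cosh (a * (2 * k + 1))))) = _
      rw [hcosh, sub_neg_eq_add]
      have h1 : (1 + s ^ 2) ≠ 0 := by positivity
      have h2 : (2 * (k : ℝ) + 1) ≠ 0 := by positivity
      field_simp
      ring
    rw [e1, e2]
    exact hg2
  rw [tsum_congr (fun k => (hinner k).tsum_eq)]
  have hh : Summable h := (hsum.prod_symm.hasSum.prod_fiberwise (fun k => hinner k)).summable
  have he : Summable (fun k => h (2 * k)) := hh.comp_injective (mul_right_injective₀ two_ne_zero)
  have ho : Summable (fun k => h (2 * k + 1)) := hh.comp_injective hinj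
  rw [← tsum_even_add_odd he ho, ← he.tsum_add ho, KK, ← tsum_mul_left]
  refine tsum_congr (fun q => ?_)
  simp only [h, pr]
  rw [pow_succ, pow_mul]
  push_cast
  rw [show 2 * (2 * (q : ℝ)) + 1 = 4 * q + 1 by ring, show 2 * (2 * (q : ℝ) + 1) + 1 = 4 * q + 3 by ring]
  have h1 := (Real.cosh_pos (a * (4 * q + 1))).ne'
  have h3 := (Real.cosh_pos (a * (4 * q + 3))).ne'
  have hpi := Real.pi_ne_zero
  norm_num
  field_simp
  ring

theorem jacobi_modular_angle_transformation (α β : ℝ) (hα : 0 < α) (hβ : 0 < β)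
    (hαβ : α * β = π ^ 2 / 4) :
    (∑' n : ℕ, Real.sin (π * n / 2) * Real.arctan (Real.exp (-(α * n)))) +
    (∑' n : ℕ, Real.sin (π * n / 2) * Real.arctan (Real.exp (-(β * n)))) = π / 8 := by
  rw [arctan_sum α hα, arctan_sum β hβ, ← mul_add, KK_add α β hα hβ hαβ]
  field_simp
  norm_num
end

section
/- Let α, β be positive reals with αβ = π²/9. Then Σ_{n=0}^{∞} χ₃(n−1) · arctan( √3 / (1 − 2 e^{α(2n+1)}) ) + Σ_{n=0}^{∞} χ₃(n−1) · arctan( √3 / (1 − 2 e^{β(2n+1)}) ) = 2π/9. -/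
open Real

/-- The Legendre symbol modulo 3, as a real-valued function on the integers. -/
noncomputable def chi3 (j : ℤ) : ℝ :=
  if j % 3 = 0 then 0 else if j % 3 = 1 then 1 else -1

namespace Mod3
open Set Filter Topology MeasureTheory

/-- Gaussian primitive. -/
noncomputable def G (x : ℝ) : ℝ := ∫ s in (0:ℝ)..x, rexp (-1 * s ^ 2)

lemma G_deriv (x : ℝ) : HasDerivAt G (rexp (-1 * x ^ 2)) x := by
  have hc : Continuous fun s : ℝ => rexp (-1 * s ^ 2) := by fun_prop
  exact intervalIntegral.integral_hasDerivAt_right (hc.intervalIntegrable _ _)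
    (hc.stronglyMeasurableAtFilter _ _) hc.continuousAt

lemma G_top : Tendsto G atTop (𝓝 (√π / 2)) := by
  have h := intervalIntegral_tendsto_integral_Ioi (μ := volume) (0:ℝ)
    (integrable_exp_neg_mul_sq one_pos).integrableOn tendsto_id
  rw [integral_gaussian_Ioi] at h
  rw [div_one] at h
  exact h

lemma G_odd (x : ℝ) : G (-x) = - G x := by
  unfold G
  have := intervalIntegral.integral_comp_neg (a := 0) (b := x) (fun s : ℝ => rexp (-1 * s ^ 2))
  simp only [neg_sq, neg_zero] at this
  rw [this, intervalIntegral.integral_symm]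

lemma G_bot : Tendsto G atBot (𝓝 (-(√π / 2))) := by
  have h := (G_top.comp tendsto_neg_atBot_atTop).neg
  refine h.congr fun x => ?_
  simp [G_odd]

/-- the primitive -/
noncomputable def Fp (p q t : ℝ) : ℝ :=
  (rexp (-2 * p * q) * G (p * √t - q * (√t)⁻¹) - rexp (2 * p * q) * G (p * √t + q * (√t)⁻¹)) / q

lemma Fp_deriv {p q t : ℝ} (hq : 0 < q) (ht : 0 < t) :
    HasDerivAt (Fp p q) (rexp (-p ^ 2 * t - q ^ 2 / t) / (t * √t)) t := by
  have hs : 0 < √t := Real.sqrt_pos.2 ht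
  have h1 := Real.hasDerivAt_sqrt ht.ne'
  have h2 := h1.inv hs.ne'
  have hu := (h1.const_mul p).sub (h2.const_mul q)
  have hv := (h1.const_mul p).add (h2.const_mul q)
  have key := ((((G_deriv _).comp t hu).const_mul (rexp (-2 * p * q))).sub
    (((G_deriv _).comp t hv).const_mul (rexp (2 * p * q)))).div_const q
  have hst : √t ^ 2 = t := Real.sq_sqrt ht.le
  refine HasDerivAt.congr_deriv (f := Fp p q) key ?_
  have aux1 : ∀ S : ℝ, 0 < S → S ^ 2 = t →
      -1 * (p * S - q * S⁻¹) ^ 2 = -p ^ 2 * t - q ^ 2 / t + 2 * p * q := by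
    rintro S hS rfl; field_simp; ring
  have aux2 : ∀ S : ℝ, 0 < S → S ^ 2 = t →
      -1 * (p * S + q * S⁻¹) ^ 2 = -p ^ 2 * t - q ^ 2 / t + -2 * p * q := by
    rintro S hS rfl; field_simp; ring
  have e1 : rexp (-1 * (p * √t - q * (√t)⁻¹) ^ 2) =
      rexp (-p ^ 2 * t - q ^ 2 / t) * rexp (2 * p * q) := by
    rw [← Real.exp_add]; congr 1
    exact aux1 _ hs hst
  have e2 : rexp (-1 * (p * √t + q * (√t)⁻¹) ^ 2) =
      rexp (-p ^ 2 * t - q ^ 2 / t) * rexp (-2 * p * q) := by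
    rw [← Real.exp_add]; congr 1
    exact aux2 _ hs hst
  have e3 : rexp (-2 * p * q) = (rexp (2 * p * q))⁻¹ := by
    rw [← Real.exp_neg]; congr 1; ring
  simp only [Pi.sub_apply, Pi.add_apply, Pi.inv_apply]
  rw [e1, e2, e3]
  generalize rexp (-p ^ 2 * t - q ^ 2 / t) = E
  have := (Real.exp_pos (2 * p * q)).ne'
  generalize rexp (2 * p * q) = X at *
  rw [hst]
  field_simp
  ring

lemma gl {p q : ℝ} (hp : 0 < p) (hq : 0 < q) :
    IntegrableOn (fun t => rexp (-p ^ 2 * t - q ^ 2 / t) / (t * √t)) (Ioi 0) ∧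
    ∫ t in Ioi 0, rexp (-p ^ 2 * t - q ^ 2 / t) / (t * √t) = √π / q * rexp (-2 * p * q) := by
  set l0 : ℝ := (rexp (-2 * p * q) * (-(√π / 2)) - rexp (2 * p * q) * (√π / 2)) / q with hl0
  set l1 : ℝ := (rexp (-2 * p * q) * (√π / 2) - rexp (2 * p * q) * (√π / 2)) / q with hl1
  have hs0 : Tendsto (fun t : ℝ => √t) (𝓝[>] 0) (𝓝[>] 0) := by
    refine tendsto_nhdsWithin_iff.2 ⟨?_, ?_⟩
    · have := (Real.continuous_sqrt.tendsto 0)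
      rw [Real.sqrt_zero] at this
      exact this.mono_left nhdsWithin_le_nhds
    · filter_upwards [self_mem_nhdsWithin] with t ht using Real.sqrt_pos.2 ht
  have hi0 : Tendsto (fun t : ℝ => q * (√t)⁻¹) (𝓝[>] 0) atTop :=
    (tendsto_inv_nhdsGT_zero.comp hs0).const_mul_atTop hq
  have hz0 : Tendsto (fun t : ℝ => p * √t) (𝓝[>] 0) (𝓝 (p * 0)) :=
    (hs0.mono_right nhdsWithin_le_nhds).const_mul p
  have hs1 : Tendsto (fun t : ℝ => p * √t) atTop atTop :=
    Real.tendsto_sqrt_atTop.const_mul_atTop hp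
  have hi1 : Tendsto (fun t : ℝ => q * (√t)⁻¹) atTop (𝓝 (q * 0)) :=
    (tendsto_inv_atTop_zero.comp Real.tendsto_sqrt_atTop).const_mul q
  have u0 : Tendsto (fun t : ℝ => p * √t - q * (√t)⁻¹) (𝓝[>] 0) atBot := by
    simp_rw [sub_eq_add_neg]
    exact hz0.add_atBot (tendsto_neg_atTop_atBot.comp hi0)
  have v0 : Tendsto (fun t : ℝ => p * √t + q * (√t)⁻¹) (𝓝[>] 0) atTop := hz0.add_atTop hi0
  have u1 : Tendsto (fun t : ℝ => p * √t - q * (√t)⁻¹) atTop atTop := by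
    simp_rw [sub_eq_add_neg]
    exact hs1.atTop_add hi1.neg
  have v1 : Tendsto (fun t : ℝ => p * √t + q * (√t)⁻¹) atTop atTop := hs1.atTop_add hi1
  have F0 : Tendsto (Fp p q) (𝓝[>] 0) (𝓝 l0) :=
    (((G_bot.comp u0).const_mul _).sub ((G_top.comp v0).const_mul _)).div_const q
  have F1 : Tendsto (Fp p q) atTop (𝓝 l1) :=
    (((G_top.comp u1).const_mul _).sub ((G_top.comp v1).const_mul _)).div_const q
  have hpos : ∀ t ∈ Ioi (0:ℝ), 0 ≤ rexp (-p ^ 2 * t - q ^ 2 / t) / (t * √t) := by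
    intro t ht
    have : (0:ℝ) < t := ht
    positivity
  have hcont : ContinuousWithinAt (Function.update (Fp p q) 0 l0) (Ici 0) 0 := by
    rw [continuousWithinAt_update_same]
    simpa using F0
  have hd : ∀ t ∈ Ioi (0:ℝ), HasDerivAt (Function.update (Fp p q) 0 l0)
      (rexp (-p ^ 2 * t - q ^ 2 / t) / (t * √t)) t := by
    intro t ht
    refine (Fp_deriv hq ht).congr_of_eventuallyEq ?_
    filter_upwards [Ioi_mem_nhds ht] with s hs
    rw [Function.update_of_ne (ne_of_gt hs)]
  have hlim : Tendsto (Function.update (Fp p q) 0 l0) atTop (𝓝 l1) := by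
    refine F1.congr' ?_
    filter_upwards [Ioi_mem_atTop (0:ℝ)] with s hs
    rw [Function.update_of_ne (ne_of_gt hs)]
  refine ⟨integrableOn_Ioi_deriv_of_nonneg hcont hd hpos hlim, ?_⟩
  rw [integral_Ioi_of_hasDerivAt_of_nonneg hcont hd hpos hlim, Function.update_self, hl0, hl1]
  field_simp
  ring


/-- shifted integers -/
noncomputable def w (n : ℤ) : ℝ := (n : ℝ) + 1 / 6

/-- sine coefficients -/
noncomputable def sk (k : ℕ) : ℝ := Real.sin (2 * π * (1 / 6) * k)

lemma abs_sk (k : ℕ) : |sk k| ≤ 1 := Real.abs_sin_le_one _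

lemma sk_zero : sk 0 = 0 := by simp [sk]

lemma w_nat (n : ℕ) : w n = (6 * n + 1) / 6 := by simp [w]; ring

lemma w_neg (n : ℕ) : w (-(n + 1)) = -((6 * n + 5) / 6) := by simp [w]; ring

lemma abs_w_nat (n : ℕ) : |w n| = (6 * n + 1) / 6 := by
  rw [w_nat, abs_of_pos (by positivity)]

lemma abs_w_neg (n : ℕ) : |w (-(n + 1))| = (6 * n + 5) / 6 := by
  rw [w_neg, abs_neg, abs_of_pos (by positivity)]

lemma abs_w_ge (n : ℤ) : 1 / 6 ≤ |w n| := by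
  obtain ⟨m, rfl | rfl⟩ := n.eq_nat_or_neg
  · rw [abs_w_nat]; have : (0:ℝ) ≤ m := by positivity
    linarith
  · rcases m with _ | m
    · simp [w]
    · have := abs_w_neg m
      push_cast
      rw [this]; have : (0:ℝ) ≤ m := by positivity
      linarith

lemma summable_lin {c d r : ℝ} (hc : 0 < c) :
    Summable (fun n : ℕ => (6 * (n : ℝ) + d) / 6 * rexp (-c * ((6 * n + r) / 6))) := by
  have h1 := Real.summable_pow_mul_exp_neg_nat_mul 1 hc
  have h0 := Real.summable_pow_mul_exp_neg_nat_mul 0 hc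
  have := (h1.add (h0.mul_left (d / 6))).mul_left (rexp (-c * r / 6))
  refine this.congr fun n => ?_
  have : rexp (-c * ((6 * n + r) / 6)) = rexp (-c * r / 6) * rexp (-c * n) := by
    rw [← Real.exp_add]; congr 1; ring
  rw [this]; ring

lemma summable_w {c : ℝ} (hc : 0 < c) : Summable (fun n : ℤ => |w n| * rexp (-c * |w n|)) := by
  refine Summable.of_nat_of_neg_add_one ?_ ?_
  · simp_rw [abs_w_nat]; exact summable_lin hc
  · simp_rw [abs_w_neg]; exact summable_lin hc

lemma summable_pair {c : ℝ} (hc : 0 < c) :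
    Summable (fun p : ℤ × ℕ => |w p.1| * |sk p.2| * rexp (-c * |w p.1| * p.2)) := by
  have h1 := summable_w (half_pos hc)
  have h0 := Real.summable_pow_mul_exp_neg_nat_mul 0 (show 0 < c / 12 by positivity)
  have := h1.mul_of_nonneg h0 (fun _ => by positivity) (fun _ => by positivity)
  refine Summable.of_nonneg_of_le (fun _ => by positivity) ?_ this
  rintro ⟨n, k⟩
  simp only [pow_zero, one_mul]
  rcases Nat.eq_zero_or_pos k with rfl | hk
  · rw [sk_zero]; simp; positivity
  have hk1 : (1:ℝ) ≤ k := by exact_mod_cast hk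
  have hw := abs_w_ge n
  calc |w n| * |sk k| * rexp (-c * |w n| * k) ≤ |w n| * 1 * rexp (-(c / 2) * |w n| + -(c / 12) * k) := by
        gcongr
        · exact abs_sk k
        · nlinarith [mul_nonneg hc.le (mul_nonneg (sub_nonneg.2 hk1) (abs_nonneg (w n))),
            mul_nonneg hc.le (mul_nonneg (sub_nonneg.2 hw) (sub_nonneg.2 hk1)), mul_nonneg hc.le (sub_nonneg.2 hw)]
    _ = _ := by rw [Real.exp_add]; ring

/-- terms of the double series -/
noncomputable def ft (α β : ℝ) (p : ℤ × ℕ) (t : ℝ) : ℝ :=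
  (w p.1 * rexp (-π * w p.1 ^ 2 * (α * t))) *
    (1 / (β * t) ^ (3 / 2 : ℝ) * (2 * p.2 * sk p.2 * rexp (-π * p.2 ^ 2 * (1 / (β * t)))))

lemma rpow32 {x : ℝ} (hx : 0 < x) : x ^ (3 / 2 : ℝ) = x * √x := by
  rw [show (3 / 2 : ℝ) = 1 + 1 / 2 by norm_num, Real.rpow_add hx, Real.rpow_one, Real.sqrt_eq_rpow]

lemma ft_eq {α β : ℝ} (hα : 0 < α) (hβ : 0 < β) (p : ℤ × ℕ) {t : ℝ} (ht : 0 < t) :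
    ft α β p t = (w p.1 * (2 * p.2 * sk p.2) / (β * √β)) *
      (rexp (-(√(π * α) * |w p.1|) ^ 2 * t - (√(π / β) * p.2) ^ 2 / t) / (t * √t)) := by
  have h1 : (√(π * α) * |w p.1|) ^ 2 = π * α * w p.1 ^ 2 := by
    rw [mul_pow, sq_abs, Real.sq_sqrt (by positivity)]
  have h2 : (√(π / β) * p.2) ^ 2 = π / β * p.2 ^ 2 := by
    rw [mul_pow, Real.sq_sqrt (by positivity)]
  rw [h1, h2, ft, rpow32 (by positivity), Real.sqrt_mul hβ.le]
  have h3 : rexp (-(π * α * w p.1 ^ 2) * t - π / β * p.2 ^ 2 / t) =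
    rexp (-π * w p.1 ^ 2 * (α * t)) * rexp (-π * p.2 ^ 2 * (1 / (β * t))) := by
    rw [← Real.exp_add]; congr 1; field_simp; ring
  rw [h3]
  have := Real.sqrt_pos.2 ht
  have := Real.sqrt_pos.2 hβ
  field_simp

lemma ft_int {α β : ℝ} (hα : 0 < α) (hβ : 0 < β) (p : ℤ × ℕ) :
    IntegrableOn (ft α β p) (Ioi 0) ∧
    ∫ t in Ioi 0, ft α β p t =
      2 / β * (w p.1 * sk p.2 * rexp (-(2 * π * √(α / β)) * |w p.1| * p.2)) ∧
    ∫ t in Ioi 0, ‖ft α β p t‖ =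
      2 / β * (|w p.1| * |sk p.2| * rexp (-(2 * π * √(α / β)) * |w p.1| * p.2)) := by
  rcases p with ⟨n, k⟩
  rcases Nat.eq_zero_or_pos k with rfl | hk
  · have : ft α β (n, 0) = fun _ => 0 := by
      funext t; simp [ft]
    rw [this]
    simp [sk_zero]
  have hk1 : (0:ℝ) < k := by exact_mod_cast hk
  have hw : 0 < |w n| := lt_of_lt_of_le (by norm_num) (abs_w_ge n)
  obtain ⟨i1, i2⟩ := gl (p := √(π * α) * |w n|) (q := √(π / β) * k)
    (by have := Real.sqrt_pos.2 (mul_pos pi_pos hα); positivity)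
    (by have := Real.sqrt_pos.2 (div_pos pi_pos hβ); positivity)
  have hsq : √(π * α) * √(π / β) = π * √(α / β) := by
    rw [← Real.sqrt_mul (by positivity), show π * α * (π / β) = π ^ 2 * (α / β) by ring,
      Real.sqrt_mul (by positivity), Real.sqrt_sq pi_pos.le]
  have hexp : rexp (-2 * (√(π * α) * |w n|) * (√(π / β) * k)) =
      rexp (-(2 * π * √(α / β)) * |w n| * k) := by
    congr 1
    linear_combination (-2 * |w n| * k) * hsq
  have hc : √π / (√(π / β) * k) = √β / k := by
    rw [Real.sqrt_div pi_pos.le]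
    have := Real.sqrt_pos.2 pi_pos
    have := Real.sqrt_pos.2 hβ
    field_simp
  rw [hexp, hc] at i2
  have hb := Real.sqrt_pos.2 hβ
  refine ⟨?_, ?_, ?_⟩
  · exact IntegrableOn.congr_fun (Integrable.const_mul i1 _) (fun t ht => (ft_eq hα hβ (n, k) ht).symm) measurableSet_Ioi
  · rw [setIntegral_congr_fun measurableSet_Ioi (fun t ht => ft_eq hα hβ (n, k) ht),
      integral_const_mul, i2]
    simp only
    field_simp
  · have : ∀ t ∈ Ioi (0:ℝ), ‖ft α β (n, k) t‖ = (|w n| * (2 * k * |sk k|) / (β * √β)) *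
      (rexp (-(√(π * α) * |w n|) ^ 2 * t - (√(π / β) * k) ^ 2 / t) / (t * √t)) := by
      intro t ht
      have ht : 0 < t := ht
      rw [ft_eq hα hβ (n, k) ht, Real.norm_eq_abs, abs_mul, abs_div, abs_mul, abs_mul, abs_mul,
        abs_of_pos (show 0 < β * √β by positivity), abs_of_pos hk1,
        abs_of_pos (show (0:ℝ) < 2 by norm_num)]
      congr 1
      exact abs_of_pos (by positivity)
    rw [setIntegral_congr_fun measurableSet_Ioi this, integral_const_mul, i2]
    field_simp

/-- product of kernels, integrated -/
noncomputable def J (α β : ℝ) : ℝ :=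
  ∫ t in Ioi (0:ℝ), HurwitzZeta.oddKernel ((1 / 6 : ℝ) : UnitAddCircle) (α * t) *
    HurwitzZeta.oddKernel ((1 / 6 : ℝ) : UnitAddCircle) (β * t)

lemma J_symm (α β : ℝ) : J α β = J β α := by
  unfold J; simp_rw [mul_comm]

lemma ft_hasSum {α β : ℝ} (hα : 0 < α) (hβ : 0 < β) {t : ℝ} (ht : 0 < t) :
    HasSum (fun p => ft α β p t) (HurwitzZeta.oddKernel ((1 / 6 : ℝ) : UnitAddCircle) (α * t) *
    HurwitzZeta.oddKernel ((1 / 6 : ℝ) : UnitAddCircle) (β * t)) := by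
  have h1 := HurwitzZeta.hasSum_int_oddKernel (1 / 6) (mul_pos hα ht)
  have h2 := (HurwitzZeta.hasSum_nat_sinKernel (1 / 6)
    (one_div_pos.2 (mul_pos hβ ht))).mul_left (1 / (β * t) ^ (3 / 2 : ℝ))
  rw [← HurwitzZeta.oddKernel_functional_equation] at h2
  have h3 := h1.mul h2 (summable_mul_of_summable_norm h1.summable.norm h2.summable.norm)
  refine h3.congr_fun fun p => ?_
  simp only [ft, w, sk]

lemma J_hasSum {α β : ℝ} (hα : 0 < α) (hβ : 0 < β) :
    HasSum (fun p : ℤ × ℕ => 2 / β * (w p.1 * sk p.2 * rexp (-(2 * π * √(α / β)) * |w p.1| * p.2)))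
      (J α β) := by
  have hc : 0 < 2 * π * √(α / β) := by
    have := Real.sqrt_pos.2 (div_pos hα hβ); have := pi_pos; positivity
  have hs : Summable fun p : ℤ × ℕ => ∫ t in Ioi 0, ‖ft α β p t‖ := by
    simp_rw [fun p => (ft_int hα hβ p).2.2]
    exact (summable_pair hc).mul_left _
  have := hasSum_integral_of_summable_integral_norm (fun p => (ft_int hα hβ p).1) hs
  simp_rw [fun p => (ft_int hα hβ p).2.1] at this
  rw [setIntegral_congr_fun measurableSet_Ioi (fun t ht => (ft_hasSum hα hβ ht).tsum_eq)] at this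
  exact this

/-- minus the derivative of the arctangent term -/
noncomputable def g (x : ℝ) : ℝ := √3 / 2 * (rexp x / (rexp x ^ 2 - rexp x + 1))

lemma g_hasSum {x : ℝ} (hx : 0 < x) : HasSum (fun k : ℕ => sk k * rexp (-x * k)) (g x) := by
  set z : ℂ := Complex.exp (-x + (π / 3) * Complex.I) with hz
  have hn : ‖z‖ < 1 := by
    rw [hz, Complex.norm_exp]; simp [hx]
  have h := Complex.hasSum_im (hasSum_geometric_of_norm_lt_one hn)
  convert h using 1
  · funext k
    rw [hz, ← Complex.exp_nat_mul, Complex.exp_im]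
    simp [sk]
    rw [mul_comm]; congr 2 <;> ring_nf
  · have hre : z.re = rexp (-x) / 2 := by
      rw [hz, Complex.exp_re]; 
      have : ((π:ℂ) / 3) = ((π / 3 : ℝ) : ℂ) := by push_cast; rfl
      rw [this]; simp; ring
    have him : z.im = rexp (-x) * (√3 / 2) := by
      rw [hz, Complex.exp_im]; 
      have : ((π:ℂ) / 3) = ((π / 3 : ℝ) : ℂ) := by push_cast; rfl
      rw [this]; simp
    rw [Complex.inv_im, Complex.normSq_apply]
    simp only [Complex.sub_re, Complex.sub_im, Complex.one_re, Complex.one_im, hre, him, g,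
      Real.exp_neg]
    have h3 : √3 ^ 2 = 3 := Real.sq_sqrt (by norm_num)
    have he := Real.exp_pos x
    generalize rexp x = E at *
    have e1 : (1 - E⁻¹ / 2) * (1 - E⁻¹ / 2) + (0 - E⁻¹ * (√3 / 2)) * (0 - E⁻¹ * (√3 / 2)) =
      (E ^ 2 - E + 1) / E ^ 2 := by
      field_simp; ring_nf; rw [h3]; ring
    rw [e1]
    have : E ^ 2 - E + 1 ≠ 0 := by nlinarith [sq_nonneg (E - 1)]
    field_simp
    ring

/-- minus the derivative of the series -/
noncomputable def dt (α : ℝ) (j : ℕ) : ℝ :=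
  (6 * j + 1) * g (α * (6 * j + 1)) - (6 * j + 5) * g (α * (6 * j + 5))

lemma dt_hasSum {α β : ℝ} (hα : 0 < α) (hβ : 0 < β) (hαβ : α * β = π ^ 2 / 9) :
    HasSum (dt α) (3 * β * J α β) := by
  have h := J_hasSum hα hβ
  have hsq : 2 * π * √(α / β) = 6 * α := by
    have : α / β = (3 * α / π) ^ 2 := by
      have := pi_pos
      field_simp
      linear_combination (-9) * hαβ
    rw [this, Real.sqrt_sq (by have := pi_pos; positivity)]
    have := pi_pos
    field_simp; ring
  rw [hsq] at h
  have h2 : HasSum (fun n : ℤ => 2 / β * (w n * g (6 * α * |w n|))) (J α β) := by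
    refine h.prod_fiberwise fun n => ?_
    have hw : 0 < |w n| := lt_of_lt_of_le (by norm_num) (abs_w_ge n)
    have := ((g_hasSum (x := 6 * α * |w n|) (by positivity)).mul_left (w n)).mul_left (2 / β)
    refine this.congr_fun fun k => ?_
    ring_nf
  have h3 := h2.nat_add_neg_add_one.mul_left (3 * β)
  refine h3.congr_fun fun j => ?_
  rw [abs_w_nat, abs_w_neg, w_nat, w_neg, dt]
  rw [show 6 * α * ((6 * (j:ℝ) + 1) / 6) = α * (6 * j + 1) by ring,
    show 6 * α * ((6 * (j:ℝ) + 5) / 6) = α * (6 * j + 5) by ring]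
  field_simp
  ring

lemma dt_symm {α β : ℝ} (hα : 0 < α) (hβ : 0 < β) (hαβ : α * β = π ^ 2 / 9) :
    α * ∑' j, dt α j = β * ∑' j, dt β j := by
  rw [(dt_hasSum hα hβ hαβ).tsum_eq, (dt_hasSum hβ hα (by rw [mul_comm, hαβ])).tsum_eq, J_symm β α]
  ring

/-- the arctangent term -/
noncomputable def A (x : ℝ) : ℝ := Real.arctan (√3 / (2 * rexp x - 1))

lemma exp_one_le {x : ℝ} (hx : 0 ≤ x) : 1 ≤ rexp x := Real.one_le_exp hx

lemma A_deriv {x : ℝ} (hx : 0 ≤ x) : HasDerivAt A (-g x) x := by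
  have he := exp_one_le hx
  have hne : 2 * rexp x - 1 ≠ 0 := by linarith
  have h1 : HasDerivAt (fun y => 2 * rexp y - 1) (2 * rexp x) x :=
    ((Real.hasDerivAt_exp x).const_mul 2).sub_const 1
  have h2 := ((hasDerivAt_const x (√3)).div h1 hne).arctan
  refine HasDerivAt.congr_deriv (f := A) h2 ?_
  simp only [Pi.div_apply, g]
  have h3 : √3 ^ 2 = 3 := Real.sq_sqrt (by norm_num)
  generalize rexp x = E at *
  have hE : E ^ 2 - E + 1 ≠ 0 := by nlinarith [sq_nonneg (E - 1)]
  have e1 : 1 + (√3 / (2 * E - 1)) ^ 2 = 4 * (E ^ 2 - E + 1) / (2 * E - 1) ^ 2 := by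
    rw [div_pow, h3]; field_simp; ring
  rw [e1]
  generalize 2 * E - 1 = D at *
  generalize E ^ 2 - E + 1 = X at *
  field_simp
  ring

lemma A_nonneg {x : ℝ} (hx : 0 ≤ x) : 0 ≤ A x := by
  have he := exp_one_le hx
  exact Real.arctan_nonneg.2 (div_nonneg (Real.sqrt_nonneg _) (by linarith))

lemma A_le {x : ℝ} (hx : 0 ≤ x) : A x ≤ √3 * rexp (-x) := by
  have he := exp_one_le hx
  have h0 : 0 ≤ √3 / (2 * rexp x - 1) := div_nonneg (Real.sqrt_nonneg _) (by linarith)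
  have hle : A x ≤ √3 / (2 * rexp x - 1) := by
    have := Real.le_tan (Real.arctan_nonneg.2 h0) (Real.arctan_lt_pi_div_two _)
    rwa [Real.tan_arctan] at this
  refine hle.trans ?_
  rw [Real.exp_neg, ← div_eq_mul_inv]
  gcongr
  linarith

lemma g_nonneg (x : ℝ) : 0 ≤ g x := by
  have : 0 < rexp x ^ 2 - rexp x + 1 := by nlinarith [sq_nonneg (rexp x - 1), Real.exp_pos x]
  unfold g; positivity

lemma g_le (x : ℝ) : g x ≤ √3 * rexp (-x) := by
  unfold g
  rw [Real.exp_neg, div_mul_eq_mul_div, mul_div_assoc]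
  have he := Real.exp_pos x
  gcongr
  generalize rexp x = E at *
  have : 0 < E ^ 2 - E + 1 := by nlinarith [sq_nonneg (E - 1)]
  rw [div_div, div_le_iff₀ (by positivity)]
  field_simp
  nlinarith [sq_nonneg (E - 1)]

lemma g_anti {x y : ℝ} (hx : 0 ≤ x) (hxy : x ≤ y) : g y ≤ g x := by
  unfold g
  have h1 := exp_one_le hx
  have h2 := Real.exp_le_exp.2 hxy
  generalize rexp x = E at *
  generalize rexp y = F at *
  have : 0 < E ^ 2 - E + 1 := by nlinarith [sq_nonneg (E - 1)]
  have : 0 < F ^ 2 - F + 1 := by nlinarith [sq_nonneg (F - 1)]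
  gcongr √3 / 2 * ?_
  rw [div_le_div_iff₀ (by assumption) (by assumption)]
  nlinarith [mul_nonneg (sub_nonneg.2 h2) (show 0 ≤ E * F - 1 by nlinarith)]

lemma A_mvt {x y : ℝ} (hx : 0 ≤ x) (hxy : x < y) :
    (y - x) * g y ≤ A x - A y ∧ A x - A y ≤ (y - x) * g x := by
  obtain ⟨c, hc, h⟩ := exists_hasDerivAt_eq_slope A (fun t => -g t) hxy
    (fun t ht => (A_deriv (hx.trans ht.1)).continuousAt.continuousWithinAt)
    (fun t ht => A_deriv (hx.trans ht.1.le))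
  have h0 : 0 < y - x := sub_pos.2 hxy
  have h1 : A x - A y = (y - x) * g c := by
    field_simp at h
    linarith
  rw [h1]
  exact ⟨mul_le_mul_of_nonneg_left (g_anti (hx.trans hc.1.le) hc.2.le) h0.le,
    mul_le_mul_of_nonneg_left (g_anti hx hc.1.le) h0.le⟩

lemma A_summable {α a r : ℝ} (hα : 0 < α) (ha : 0 < a) (hr : 0 ≤ r) :
    Summable fun j : ℕ => A (α * (a * j + r)) := by
  have h := (Real.summable_pow_mul_exp_neg_nat_mul 0 (mul_pos hα ha)).mul_left (√3 * rexp (-(α * r)))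
  refine Summable.of_nonneg_of_le (fun j => A_nonneg (by positivity)) (fun j => ?_) h
  refine (A_le (by positivity)).trans (le_of_eq ?_)
  rw [pow_zero, one_mul, mul_assoc, ← Real.exp_add]
  congr 2; ring

/-- grouped series -/
noncomputable def U (α : ℝ) : ℝ := ∑' j : ℕ, (A (α * (6 * j + 1)) - A (α * (6 * j + 5)))

lemma U_bounds {α : ℝ} (hα : 0 < α) : 2 / 3 * A α ≤ U α ∧ U α ≤ A α - 1 / 3 * A (5 * α) := by
  have hP := A_summable (a := 6) (r := 1) hα (by norm_num) (by norm_num)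
  have hQ := A_summable (a := 6) (r := 5) hα (by norm_num) (by norm_num)
  have hP' := (summable_nat_add_iff 1).2 hP
  have hQ' := (summable_nat_add_iff 1).2 hQ
  have eP := hP.tsum_eq_zero_add
  have eQ := hQ.tsum_eq_zero_add
  have hU : U α = _ := hP.tsum_sub hQ
  have l1 := (hQ.sub hP').mul_left 2 |>.tsum_le_tsum (fun j => ?_) (hP.sub hQ)
  have l2 := (hP'.sub hQ').tsum_le_tsum (fun j => ?_) ((hQ.sub hP').mul_left 2)
  · rw [tsum_mul_left, hQ.tsum_sub hP', hP.tsum_sub hQ] at l1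
    rw [tsum_mul_left, hQ.tsum_sub hP', hP'.tsum_sub hQ'] at l2
    simp only [Nat.cast_zero, mul_zero, zero_add, mul_one] at eP eQ
    rw [mul_comm α 5] at eQ
    constructor <;> linarith
  · have a1 := (A_mvt (x := α * (6 * j + 5)) (y := α * (6 * (j + 1 : ℕ) + 1)) (by positivity)
      (by push_cast; nlinarith)).2
    have a2 := (A_mvt (x := α * (6 * (j + 1 : ℕ) + 1)) (y := α * (6 * (j + 1 : ℕ) + 5)) (by positivity)
      (by push_cast; nlinarith)).2
    have a3 := (A_mvt (x := α * (6 * j + 5)) (y := α * (6 * (j + 1 : ℕ) + 1)) (by positivity)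
      (by push_cast; nlinarith)).1
    push_cast at *
    nlinarith
  · have a1 := (A_mvt (x := α * (6 * j + 5)) (y := α * (6 * (j + 1 : ℕ) + 1)) (by positivity)
      (by push_cast; nlinarith)).2
    have a2 := (A_mvt (x := α * (6 * j + 1)) (y := α * (6 * j + 5)) (by positivity)
      (by nlinarith)).1
    push_cast at *
    nlinarith

lemma U_deriv {α : ℝ} (hα : 0 < α) : HasDerivAt U (-∑' j, dt α j) α := by
  rw [← tsum_neg]
  have h1 := (summable_lin (c := 6 * (α / 2)) (d := 1) (r := 1) (by positivity)).mul_left (6 * √3)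
  have h5 := (summable_lin (c := 6 * (α / 2)) (d := 5) (r := 5) (by positivity)).mul_left (6 * √3)
  refine hasDerivAt_tsum_of_isPreconnected (h1.add h5) isOpen_Ioi isPreconnected_Ioi
    (g := fun (j : ℕ) (y : ℝ) => A (y * (6 * j + 1)) - A (y * (6 * j + 5)))
    (g' := fun (j : ℕ) (y : ℝ) => -dt y j)
    (t := Ioi (α / 2)) (y₀ := α) (fun j y hy => ?_) (fun j y hy => ?_) (half_lt_self hα) ?_
    (half_lt_self hα)
  · have hy : 0 < y := lt_trans (half_pos hα) hy
    have d : ∀ r : ℝ, 0 < r → HasDerivAt (fun y => A (y * r)) (-g (y * r) * r) y := by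
      intro r hr
      have := (A_deriv (x := y * r) (by positivity)).comp y ((hasDerivAt_id y).mul_const r)
      simpa [Function.comp_def] using this
    refine ((d _ (by positivity)).sub (d _ (by positivity))).congr_deriv ?_
    unfold dt; ring
  · have hy' : α / 2 < y := hy
    rw [norm_neg, dt]
    refine (norm_sub_le _ _).trans ?_
    have d : ∀ r : ℝ, 0 < r → ‖r * g (y * r)‖ ≤ 6 * √3 * (r / 6 * rexp (-(6 * (α / 2)) * (r / 6))) := by
      intro r hr
      rw [norm_mul, Real.norm_of_nonneg hr.le, Real.norm_of_nonneg (g_nonneg _)]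
      have : g (y * r) ≤ √3 * rexp (-(α / 2 * r)) := by
        refine (g_le _).trans ?_
        gcongr
      calc _ ≤ r * (√3 * rexp (-(α / 2 * r))) := by gcongr
        _ = _ := by rw [show -(6 * (α / 2)) * (r / 6) = -(α / 2 * r) by ring]; ring
    exact add_le_add (d _ (by positivity)) (d _ (by positivity))
  · exact (A_summable hα (by norm_num) (by norm_num)).sub
      (A_summable hα (by norm_num) (by norm_num))

lemma A_top : Tendsto A atTop (𝓝 0) := by
  have h : Tendsto (fun x : ℝ => √3 * rexp (-x)) atTop (𝓝 (√3 * 0)) :=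
    (Real.tendsto_exp_neg_atTop_nhds_zero).const_mul _
  rw [mul_zero] at h
  refine tendsto_of_tendsto_of_tendsto_of_le_of_le' tendsto_const_nhds h ?_ ?_
  · filter_upwards [eventually_ge_atTop 0] with x hx using A_nonneg hx
  · filter_upwards [eventually_ge_atTop 0] with x hx using A_le hx

lemma A_zero : Tendsto A (𝓝 0) (𝓝 (π / 3)) := by
  have h := (A_deriv le_rfl).continuousAt.tendsto
  have : A 0 = π / 3 := by
    unfold A
    rw [Real.exp_zero, show (2 * 1 - 1 : ℝ) = 1 by norm_num, div_one, ← Real.tan_pi_div_three]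
    exact Real.arctan_tan (by linarith [pi_pos]) (by linarith [pi_pos])
  rwa [this] at h

lemma U_top : Tendsto U atTop (𝓝 0) := by
  have h1 : Tendsto (fun x => 2 / 3 * A x) atTop (𝓝 (2 / 3 * 0)) := A_top.const_mul _
  have h2 : Tendsto (fun x => A x - 1 / 3 * A (5 * x)) atTop (𝓝 (0 - 1 / 3 * 0)) :=
    A_top.sub ((A_top.comp (tendsto_id.const_mul_atTop (by norm_num))).const_mul _)
  norm_num at h1 h2
  refine tendsto_of_tendsto_of_tendsto_of_le_of_le' h1 h2 ?_ ?_
  · filter_upwards [eventually_gt_atTop 0] with x hx using (U_bounds hx).1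
  · filter_upwards [eventually_gt_atTop 0] with x hx
    have := (U_bounds hx).2
    norm_num at this ⊢; linarith

lemma U_zero : Tendsto U (𝓝[>] 0) (𝓝 (2 * π / 9)) := by
  have h1 : Tendsto (fun x => 2 / 3 * A x) (𝓝 0) (𝓝 (2 / 3 * (π / 3))) := A_zero.const_mul _
  have h5 : Tendsto (fun x : ℝ => 5 * x) (𝓝 0) (𝓝 0) := by
    have := (continuous_const_mul (5:ℝ)).tendsto 0
    simpa using this
  have h2 : Tendsto (fun x => A x - 1 / 3 * A (5 * x)) (𝓝 0) (𝓝 (π / 3 - 1 / 3 * (π / 3))) :=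
    A_zero.sub ((A_zero.comp h5).const_mul _)
  rw [show 2 / 3 * (π / 3) = 2 * π / 9 by ring] at h1
  rw [show π / 3 - 1 / 3 * (π / 3) = 2 * π / 9 by ring] at h2
  refine tendsto_of_tendsto_of_tendsto_of_le_of_le' (h1.mono_left nhdsWithin_le_nhds)
    (h2.mono_left nhdsWithin_le_nhds) ?_ ?_
  · filter_upwards [self_mem_nhdsWithin] with x hx using (U_bounds hx).1
  · filter_upwards [self_mem_nhdsWithin] with x hx using (U_bounds hx).2

lemma U_add {α β : ℝ} (hα : 0 < α) (hβ : 0 < β) (hαβ : α * β = π ^ 2 / 9) :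
    U α + U β = 2 * π / 9 := by
  set F : ℝ → ℝ := fun x => U x + U (π ^ 2 / 9 / x) with hF
  have hpi := pi_pos
  have hd : ∀ x ∈ Ioi (0:ℝ), HasDerivAt F 0 x := by
    intro x hx
    have hx : 0 < x := hx
    have hy : 0 < π ^ 2 / 9 / x := by positivity
    have h1 := U_deriv hx
    have h2 : HasDerivAt (fun x => π ^ 2 / 9 / x) (-(π ^ 2 / 9) / x ^ 2) x := by
      have := (hasDerivAt_const x (π ^ 2 / 9)).div (hasDerivAt_id x) hx.ne'
      refine this.congr_deriv ?_
      simp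
    have h3 := h1.add ((U_deriv hy).comp x h2)
    refine HasDerivAt.congr_deriv (f := F) h3 ?_
    have hs := dt_symm hx hy (by field_simp)
    have : ∑' j, dt x j = (π ^ 2 / 9 / x ^ 2) * ∑' j, dt (π ^ 2 / 9 / x) j := by
      have : ∑' j, dt x j = (x * ∑' j, dt x j) / x := by field_simp
      rw [this, hs]; field_simp
    rw [this]; ring
  have hconst : ∀ x ∈ Ioi (0:ℝ), F x = F α := by
    intro x hx
    exact isOpen_Ioi.is_const_of_deriv_eq_zero isPreconnected_Ioi
      (fun y hy => (hd y hy).differentiableAt.differentiableWithinAt)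
      (fun y hy => (hd y hy).deriv) hx hα
  have hlim : Tendsto F atTop (𝓝 (0 + 2 * π / 9)) := by
    refine U_top.add (U_zero.comp ?_)
    refine tendsto_nhdsWithin_iff.2 ⟨tendsto_const_nhds.div_atTop tendsto_id, ?_⟩
    filter_upwards [eventually_gt_atTop 0] with x hx
    simp only [mem_Ioi]; positivity
  have hlim2 : Tendsto F atTop (𝓝 (F α)) := by
    refine tendsto_const_nhds.congr' ?_
    filter_upwards [eventually_gt_atTop 0] with x hx using (hconst x hx).symm
  have := tendsto_nhds_unique hlim2 hlim
  rw [zero_add] at this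
  rw [← this, hF]
  simp only
  congr 2
  field_simp
  linear_combination 9 * hαβ

lemma term_eq (α : ℝ) (n : ℕ) : chi3 ((n : ℤ) - 1) *
    Real.arctan (Real.sqrt 3 / (1 - 2 * Real.exp (α * (2 * n + 1)))) =
    -chi3 ((n : ℤ) - 1) * A (α * (2 * n + 1)) := by
  unfold A
  rw [show 1 - 2 * rexp (α * (2 * n + 1)) = -(2 * rexp (α * (2 * n + 1)) - 1) by ring, div_neg,
    Real.arctan_neg]
  ring

lemma abs_chi3 (j : ℤ) : |chi3 j| ≤ 1 := by
  unfold chi3; split_ifs <;> simp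

lemma series_eq {α : ℝ} (hα : 0 < α) : (∑' n : ℕ, chi3 ((n : ℤ) - 1) *
    Real.arctan (Real.sqrt 3 / (1 - 2 * Real.exp (α * (2 * n + 1))))) = U α := by
  simp_rw [term_eq]
  have hs : Summable fun n : ℕ => -chi3 ((n : ℤ) - 1) * A (α * (2 * n + 1)) := by
    refine (A_summable (a := 2) (r := 1) hα (by norm_num) (by norm_num)).of_norm_bounded fun n => ?_
    rw [norm_mul, norm_neg, Real.norm_of_nonneg (A_nonneg (by positivity)), Real.norm_eq_abs]
    exact mul_le_of_le_one_left (A_nonneg (by positivity)) (abs_chi3 _)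
  rw [Nat.sumByResidueClasses hs 3]
  have hP := A_summable (a := 6) (r := 1) hα (by norm_num) (by norm_num)
  have hQ := A_summable (a := 6) (r := 5) hα (by norm_num) (by norm_num)
  have hU : U α = _ := hP.tsum_sub hQ
  have c0 : ∀ m : ℕ, chi3 (((0 + 3 * m : ℕ) : ℤ) - 1) = -1 := by
    intro m; unfold chi3; rw [if_neg (by omega), if_neg (by omega)]
  have c1 : ∀ m : ℕ, chi3 (((1 + 3 * m : ℕ) : ℤ) - 1) = 0 := by
    intro m; unfold chi3; rw [if_pos (by omega)]
  have c2 : ∀ m : ℕ, chi3 (((2 + 3 * m : ℕ) : ℤ) - 1) = 1 := by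
    intro m; unfold chi3; rw [if_neg (by omega), if_pos (by omega)]
  have : ∀ F : ZMod 3 → ℝ, ∑ j : ZMod 3, F j = F 0 + F 1 + F 2 := fun F => Fin.sum_univ_three F
  rw [this]
  have v0 : (0 : ZMod 3).val = 0 := rfl
  have v1 : (1 : ZMod 3).val = 1 := rfl
  have v2 : (2 : ZMod 3).val = 2 := rfl
  rw [v0, v1, v2]
  simp_rw [c0, c1, c2]
  rw [hU, sub_eq_add_neg, ← tsum_neg]
  simp only [neg_neg, one_mul, neg_zero, zero_mul, tsum_zero, add_zero, neg_mul]
  congr 1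
  · refine tsum_congr fun m => ?_
    congr 2; push_cast; ring
  · refine tsum_congr fun m => ?_
    congr 3; push_cast; ring

end Mod3

theorem modular_transformation_mod3 (α β : ℝ) (hα : 0 < α) (hβ : 0 < β)
    (hαβ : α * β = π ^ 2 / 9) :
    (∑' n : ℕ, chi3 ((n : ℤ) - 1) *
      Real.arctan (Real.sqrt 3 / (1 - 2 * Real.exp (α * (2 * n + 1))))) +
    (∑' n : ℕ, chi3 ((n : ℤ) - 1) *
      Real.arctan (Real.sqrt 3 / (1 - 2 * Real.exp (β * (2 * n + 1))))) =
    2 * π / 9 := by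
  rw [Mod3.series_eq hα, Mod3.series_eq hβ]
  exact Mod3.U_add hα hβ hαβ
end
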